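/- Let D be a bounded domain in ℝⁿ, n ≥ 2. Then D is a uniform domain if and only if there exists a constant c₁ ≥ 1 such that for all points x, y ∈ D, m_D(x, y) ≤ c₁·j_D(x, y). -/

import Mathlib

open Metric Set

variable {E : Type*} [NormedAddCommGroup E] [NormedSpace ℝ E]

/-- δ_D(z): the Euclidean distance from `z` to the boundary `∂D`. -/
noncomputable def bdist (D : Set E) (z : E) : ℝ := Metric.infDist z (frontier D)

/-- The m-density `m_D(z) = d(D) / (δ_D(z)·(d(D) − δ_D(z)))`. -/
noncomputable def mDensity (D : Set E) (z : E) : ℝ :=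
  Metric.diam D / (bdist D z * (Metric.diam D - bdist D z))

/-- A rectifiable path in `D` from `x` to `y`, modeled as a Lipschitz map on `[0,1]`. -/
def IsRectPathIn (D : Set E) (x y : E) (γ : ℝ → E) : Prop :=
  (∃ K : NNReal, LipschitzWith K γ) ∧ γ 0 = x ∧ γ 1 = y ∧ ∀ t ∈ Set.Icc (0:ℝ) 1, γ t ∈ D

/-- The line integral `∫_γ ρ(z) |dz|` of a density `ρ` along a path `γ`. -/
noncomputable def pathIntegral (ρ : E → ℝ) (γ : ℝ → E) : ℝ :=
  ∫ t in (0:ℝ)..1, ρ (γ t) * ‖deriv γ t‖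

/-- `inf_γ ∫_γ ρ(z)|dz|` over all rectifiable paths `γ` joining `x` and `y` in `D`. -/
noncomputable def pathDist (ρ : E → ℝ) (D : Set E) (x y : E) : ℝ :=
  sInf (pathIntegral ρ '' {γ | IsRectPathIn D x y γ})

/-- The metric `m_D`. -/
noncomputable def mDist (D : Set E) (x y : E) : ℝ := pathDist (mDensity D) D x y

/-- The quasihyperbolic metric `k_D`. -/
noncomputable def kDist (D : Set E) (x y : E) : ℝ :=
  pathDist (fun z => 1 / bdist D z) D x y

/-- The Euclidean length of the subarc of `γ` over the parameter interval `[s,t]`. -/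
noncomputable def subarcLength (γ : ℝ → E) (s t : ℝ) : ENNReal :=
  eVariationOn γ (Set.Icc s t)

/-- A domain `D` is `c`-uniform: each pair of points of `D` can be joined by a
rectifiable arc `γ ⊂ D` satisfying the double cone condition
`min_j ℓ(γ(z_j, z)) ≤ c·δ_D(z)` for all `z ∈ γ`, together with the quasi-convexity
condition `ℓ(γ) ≤ c·|z₁ − z₂|`. -/
def IsUniformDomain (D : Set E) : Prop :=
  ∃ c : ℝ, 1 ≤ c ∧ ∀ x ∈ D, ∀ y ∈ D, ∃ γ : ℝ → E, IsRectPathIn D x y γ ∧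
    (∀ t ∈ Set.Icc (0:ℝ) 1,
      min (subarcLength γ 0 t) (subarcLength γ t 1)
        ≤ ENNReal.ofReal (c * bdist D (γ t))) ∧
    subarcLength γ 0 1 ≤ ENNReal.ofReal (c * dist x y)

/-- The distance ratio metric $j_D$. -/
noncomputable def jDist (D : Set E) (x y : E) : ℝ :=
  (1 / 2) * Real.log ((1 + dist x y / bdist D x) * (1 + dist x y / bdist D y))


/-! ### Calculus for Lipschitz functions -/

open MeasureTheory in
lemma ftc_lip {g : ℝ → ℝ} {a b : ℝ} {K : NNReal} (hab : a ≤ b)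
    (hg : LipschitzOnWith K g (Icc a b)) :
    IntervalIntegrable (deriv g) volume a b ∧ ∫ t in a..b, deriv g t = g b - g a := by
  have h : AbsolutelyContinuousOnInterval g a b := by
    apply LipschitzOnWith.absolutelyContinuousOnInterval (K := K)
    rwa [uIcc_of_le hab]
  exact ⟨h.intervalIntegrable_deriv, h.integral_deriv_eq_sub⟩

open MeasureTheory in
lemma ftc_le {g h : ℝ → ℝ} {a b : ℝ} {K : NNReal} (hab : a ≤ b)
    (hg : LipschitzOnWith K g (Icc a b)) (hh : IntervalIntegrable h volume a b)
    (hle : ∀ᵐ t, t ∈ Ioo a b → deriv g t ≤ h t) :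
    g b - g a ≤ ∫ t in a..b, h t := by
  obtain ⟨h1, h2⟩ := ftc_lip hab hg
  rw [← h2]
  apply intervalIntegral.integral_mono_ae_restrict hab h1 hh
  rw [← MeasureTheory.Measure.restrict_congr_set (Ioo_ae_eq_Icc (μ := volume) (a := a) (b := b))]
  exact (ae_restrict_iff' measurableSet_Ioo).2 hle

open MeasureTheory in
lemma ftc_ge {g h : ℝ → ℝ} {a b : ℝ} {K : NNReal} (hab : a ≤ b)
    (hg : LipschitzOnWith K g (Icc a b)) (hh : IntervalIntegrable h volume a b)
    (hle : ∀ᵐ t, t ∈ Ioo a b → h t ≤ deriv g t) :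
    ∫ t in a..b, h t ≤ g b - g a := by
  obtain ⟨h1, h2⟩ := ftc_lip hab hg
  rw [← h2]
  apply intervalIntegral.integral_mono_ae_restrict hab hh h1
  rw [← MeasureTheory.Measure.restrict_congr_set (Ioo_ae_eq_Icc (μ := volume) (a := a) (b := b))]
  exact (ae_restrict_iff' measurableSet_Ioo).2 hle

lemma log_lip {f : ℝ → ℝ} {s : Set ℝ} {K : NNReal} {m : ℝ} (hm : 0 < m)
    (hf : LipschitzOnWith K f s) (hfm : ∀ t ∈ s, m ≤ f t) :
    ∃ K' : NNReal, LipschitzOnWith K' (fun t => Real.log (f t)) s := by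
  have hlog : ∀ p q : ℝ, m ≤ p → m ≤ q → Real.log p - Real.log q ≤ m⁻¹ * |p - q| := by
    intro p q hp hq
    have hp0 : 0 < p := hm.trans_le hp
    have hq0 : 0 < q := hm.trans_le hq
    rw [← Real.log_div hp0.ne' hq0.ne']
    have h1 := Real.log_le_sub_one_of_pos (div_pos hp0 hq0)
    have h2 : p / q - 1 = q⁻¹ * (p - q) := by field_simp
    have h3 : q⁻¹ ≤ m⁻¹ := inv_anti₀ hm hq
    have h4 : q⁻¹ * (p - q) ≤ q⁻¹ * |p - q| :=
      mul_le_mul_of_nonneg_left (le_abs_self _) (inv_pos.2 hq0).le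
    have h5 : q⁻¹ * |p - q| ≤ m⁻¹ * |p - q| := mul_le_mul_of_nonneg_right h3 (abs_nonneg _)
    linarith
  refine ⟨(m⁻¹).toNNReal * K, LipschitzOnWith.of_dist_le_mul ?_⟩
  intro x hx y hy
  have h1 := hf.dist_le_mul x hx y hy
  rw [Real.dist_eq] at h1
  have hmi : (0:ℝ) ≤ m⁻¹ := (inv_pos.2 hm).le
  push_cast
  rw [Real.coe_toNNReal _ hmi, Real.dist_eq, abs_le, mul_assoc]
  have h2 := mul_le_mul_of_nonneg_left h1 hmi
  have h3 := hlog _ _ (hfm x hx) (hfm y hy)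
  have h4 := hlog _ _ (hfm y hy) (hfm x hx)
  rw [abs_sub_comm] at h4
  constructor <;> linarith

open MeasureTheory in
lemma speed_integrable {V : Type*} [NormedAddCommGroup V] [InnerProductSpace ℝ V]
    [FiniteDimensional ℝ V] {γ : ℝ → V} {K : NNReal} (hγ : LipschitzWith K γ) (a b : ℝ) :
    IntervalIntegrable (fun t => ‖deriv γ t‖) volume a b := by
  let _ : MeasurableSpace V := borel V
  have _ : BorelSpace V := ⟨rfl⟩
  have hc : IntervalIntegrable (fun _ : ℝ => (K : ℝ)) volume a b := intervalIntegrable_const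
  refine hc.mono_fun ?_ ?_
  · exact ((measurable_deriv γ).norm).aestronglyMeasurable
  · refine Filter.Eventually.of_forall fun t => ?_
    simpa using norm_deriv_le_of_lipschitz hγ (x₀ := t)

lemma norm_sub_le_speed {V : Type*} [NormedAddCommGroup V] [InnerProductSpace ℝ V]
    [FiniteDimensional ℝ V] {γ : ℝ → V} {K : NNReal} (hγ : LipschitzWith K γ) {a b : ℝ}
    (hab : a ≤ b) : ‖γ b - γ a‖ ≤ ∫ t in a..b, ‖deriv γ t‖ := by
  set v := γ b - γ a with hv
  have hnn : 0 ≤ ∫ t in a..b, ‖deriv γ t‖ :=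
    intervalIntegral.integral_nonneg hab fun _ _ => norm_nonneg _
  have hf : LipschitzWith (‖innerSL ℝ v‖₊ * K) (fun t => inner ℝ v (γ t)) :=
    ((innerSL ℝ v).lipschitz).comp hγ
  have h1 := ftc_le (g := fun t => inner ℝ v (γ t)) (h := fun t => ‖v‖ * ‖deriv γ t‖) hab
    (hf.lipschitzOnWith (s := Icc a b)) ((speed_integrable hγ a b).const_mul _) (by
      filter_upwards [hγ.ae_differentiableAt_real] with t ht _
      have : HasDerivAt (fun t => inner ℝ v (γ t)) (inner ℝ v (deriv γ t)) t :=
        (innerSL ℝ v).hasFDerivAt.comp_hasDerivAt t ht.hasDerivAt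
      rw [this.deriv]
      exact real_inner_le_norm _ _)
  rw [intervalIntegral.integral_const_mul, ← inner_sub_right, ← hv, real_inner_self_eq_norm_sq] at h1
  rcases eq_or_lt_of_le (norm_nonneg v) with h0 | h0
  · rw [← h0]; exact hnn
  · nlinarith

lemma variation_le_of_edist_le {V : Type*} [PseudoEMetricSpace V] {γ : ℝ → V} {L : ℝ → ℝ} {a b : ℝ}
    (hab : a ≤ b) (hL : MonotoneOn L (Icc a b))
    (h : ∀ s ∈ Icc a b, ∀ t ∈ Icc a b, edist (γ s) (γ t) ≤ edist (L s) (L t)) :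
    eVariationOn γ (Icc a b) ≤ ENNReal.ofReal (L b - L a) := by
  have h1 : eVariationOn γ (Icc a b) ≤ eVariationOn L (Icc a b) := by
    refine iSup_le fun p => ?_
    refine le_trans (Finset.sum_le_sum fun i _ => h _ (p.2.2.2 _) _ (p.2.2.2 _)) ?_
    exact eVariationOn.sum_le p.2.2.1 p.2.2.2
  refine h1.trans ?_
  have := (hL.eVariationOn_eq (left_mem_Icc.2 hab) (right_mem_Icc.2 hab)).le
  rwa [inter_self] at this

lemma variation_le_speed {V : Type*} [NormedAddCommGroup V] [InnerProductSpace ℝ V]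
    [FiniteDimensional ℝ V] {γ : ℝ → V} {K : NNReal} (hγ : LipschitzWith K γ) {a b : ℝ}
    (hab : a ≤ b) :
    eVariationOn γ (Icc a b) ≤ ENNReal.ofReal (∫ t in a..b, ‖deriv γ t‖) := by
  have hL : ∀ s t, s ≤ t → (∫ u in a..t, ‖deriv γ u‖) - (∫ u in a..s, ‖deriv γ u‖)
      = ∫ u in s..t, ‖deriv γ u‖ := fun s t _ =>
    intervalIntegral.integral_interval_sub_left (speed_integrable hγ _ _) (speed_integrable hγ _ _)
  have hd : ∀ s t, s ≤ t → dist (γ s) (γ t) ≤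
      (∫ u in a..t, ‖deriv γ u‖) - (∫ u in a..s, ‖deriv γ u‖) := by
    intro s t hst
    rw [hL s t hst, dist_comm, dist_eq_norm]
    exact norm_sub_le_speed hγ hst
  have hm : Monotone (fun t => ∫ u in a..t, ‖deriv γ u‖) := by
    intro s t hst
    have := hd s t hst
    have h2 := dist_nonneg (x := γ s) (y := γ t)
    simp only
    linarith
  have h := variation_le_of_edist_le (γ := γ) (L := fun t => ∫ u in a..t, ‖deriv γ u‖) hab
    (hm.monotoneOn _) (by
      intro s _ t _
      rw [edist_dist, edist_dist]
      apply ENNReal.ofReal_le_ofReal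
      rcases le_total s t with hst | hst
      · rw [dist_comm (∫ u in a..s, ‖deriv γ u‖), Real.dist_eq]
        exact (hd s t hst).trans (le_abs_self _)
      · rw [dist_comm, Real.dist_eq]
        exact (hd t s hst).trans (le_abs_self _))
  simpa using h

/-! ### The boundary distance and the m-density -/

section Geometry

set_option linter.unusedSectionVars false

variable {V : Type*} [NormedAddCommGroup V] [InnerProductSpace ℝ V] [FiniteDimensional ℝ V]

lemma frontier_ne {D : Set V} (hne : D.Nonempty) (hD : D ≠ univ) : (frontier D).Nonempty :=
  nonempty_frontier_iff.2 ⟨hne, hD⟩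

lemma bdist_pos {D : Set V} (ho : IsOpen D) (hD : D ≠ univ) {z : V} (hz : z ∈ D) :
    0 < bdist D z := by
  refine (isClosed_frontier.notMem_iff_infDist_pos (frontier_ne ⟨z, hz⟩ hD)).1 ?_
  intro h
  exact (Set.disjoint_left.1 (disjoint_frontier_iff_isOpen.2 ho)) h hz

lemma bdist_lip (D : Set V) : LipschitzWith 1 (bdist D) := Metric.lipschitz_infDist_pt _

lemma bdist_le_add (D : Set V) (z w : V) : bdist D z ≤ bdist D w + dist z w :=
  Metric.infDist_le_infDist_add_dist

lemma ball_bdist_subset {D : Set V} (ho : IsOpen D) (hD : D ≠ univ) {z : V} (hz : z ∈ D) :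
    ball z (bdist D z) ⊆ D := by
  have hpos := bdist_pos ho hD hz
  refine IsPreconnected.subset_left_of_subset_union ho (isClosed_closure (s := D)).isOpen_compl ?_ ?_
    ⟨z, mem_ball_self hpos, hz⟩ (convex_ball z _).isPreconnected
  · exact Set.disjoint_left.2 fun w hw hw' => hw' (subset_closure hw)
  · intro w hw
    by_cases h : w ∈ closure D
    · left
      by_contra hwD
      have hf : w ∈ frontier D := by
        rw [frontier, ho.interior_eq]; exact ⟨h, hwD⟩
      have h1 : bdist D z ≤ dist z w := Metric.infDist_le_dist_of_mem hf
      rw [mem_ball, dist_comm] at hw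
      linarith
    · right; exact h

lemma two_bdist_le [Nontrivial V] {D : Set V} (ho : IsOpen D) (hD : D ≠ univ)
    (hb : Bornology.IsBounded D) {z : V} (hz : z ∈ D) : 2 * bdist D z ≤ Metric.diam D := by
  rw [← Metric.diam_ball_eq z (bdist_pos ho hD hz).le]
  exact Metric.diam_mono (ball_bdist_subset ho hD hz) hb

lemma inv_le_mDensity [Nontrivial V] {D : Set V} (ho : IsOpen D) (hD : D ≠ univ)
    (hb : Bornology.IsBounded D) {z : V} (hz : z ∈ D) : (bdist D z)⁻¹ ≤ mDensity D z := by
  have h1 := bdist_pos ho hD hz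
  have h2 := two_bdist_le ho hD hb hz
  rw [mDensity, inv_eq_one_div, div_le_div_iff₀ h1 (mul_pos h1 (by linarith))]
  nlinarith

lemma mDensity_le [Nontrivial V] {D : Set V} (ho : IsOpen D) (hD : D ≠ univ)
    (hb : Bornology.IsBounded D) {z : V} (hz : z ∈ D) : mDensity D z ≤ 2 * (bdist D z)⁻¹ := by
  have h1 := bdist_pos ho hD hz
  have h2 := two_bdist_le ho hD hb hz
  rw [mDensity, ← div_eq_mul_inv, div_le_div_iff₀ (mul_pos h1 (by linarith)) h1]
  nlinarith

lemma mDensity_nonneg [Nontrivial V] {D : Set V} (ho : IsOpen D) (hD : D ≠ univ)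
    (hb : Bornology.IsBounded D) {z : V} (hz : z ∈ D) : 0 ≤ mDensity D z :=
  (inv_nonneg.2 (bdist_pos ho hD hz).le).trans (inv_le_mDensity ho hD hb hz)

lemma mDensity_cont [Nontrivial V] {D : Set V} (ho : IsOpen D) (hD : D ≠ univ)
    (hb : Bornology.IsBounded D) : ContinuousOn (mDensity D) D := by
  have hc : ContinuousOn (bdist D) D := (bdist_lip D).continuous.continuousOn
  refine ContinuousOn.div continuousOn_const (hc.mul (continuousOn_const.sub hc)) ?_
  intro z hz
  have h1 := bdist_pos ho hD hz
  have h2 := two_bdist_le ho hD hb hz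
  exact (mul_pos h1 (by linarith)).ne'

open MeasureTheory in
lemma m_integrable [Nontrivial V] {D : Set V} (ho : IsOpen D) (hD : D ≠ univ)
    (hb : Bornology.IsBounded D) {γ : ℝ → V} {K : NNReal} (hγ : LipschitzWith K γ)
    (hin : ∀ t ∈ Icc (0:ℝ) 1, γ t ∈ D) {s t : ℝ} (hs : s ∈ Icc (0:ℝ) 1) (ht : t ∈ Icc (0:ℝ) 1) :
    IntervalIntegrable (fun u => mDensity D (γ u) * ‖deriv γ u‖) volume s t := by
  refine (speed_integrable hγ s t).continuousOn_mul ?_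
  have hsub : uIcc s t ⊆ Icc (0:ℝ) 1 := by
    intro u hu
    rcases le_total s t with h | h
    · rw [uIcc_of_le h] at hu; exact ⟨hs.1.trans hu.1, hu.2.trans ht.2⟩
    · rw [uIcc_of_ge h] at hu; exact ⟨ht.1.trans hu.1, hu.2.trans hs.2⟩
  exact (mDensity_cont ho hD hb).comp hγ.continuous.continuousOn fun u hu => hin u (hsub hu)

lemma pathIntegral_nonneg [Nontrivial V] {D : Set V} (ho : IsOpen D) (hD : D ≠ univ)
    (hb : Bornology.IsBounded D) {γ : ℝ → V} {x y : V} (hγ : IsRectPathIn D x y γ) :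
    0 ≤ pathIntegral (mDensity D) γ :=
  intervalIntegral.integral_nonneg zero_le_one fun t ht =>
    mul_nonneg (mDensity_nonneg ho hD hb (hγ.2.2.2 t ht)) (norm_nonneg _)

lemma mDist_le [Nontrivial V] {D : Set V} (ho : IsOpen D) (hD : D ≠ univ)
    (hb : Bornology.IsBounded D) {γ : ℝ → V} {x y : V} (hγ : IsRectPathIn D x y γ) :
    mDist D x y ≤ pathIntegral (mDensity D) γ := by
  refine csInf_le ⟨0, ?_⟩ ⟨γ, hγ, rfl⟩
  rintro _ ⟨σ, hσ, rfl⟩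
  exact pathIntegral_nonneg ho hD hb hσ

/-! ### Uniform implies `m ≤ c j` -/

lemma norm_deriv_le_deriv {γ : ℝ → V} {Λ : ℝ → ℝ} {t : ℝ}
    (h : ∀ s, t ≤ s → dist (γ t) (γ s) ≤ Λ s - Λ t) (h1 : DifferentiableAt ℝ γ t)
    (h2 : DifferentiableAt ℝ Λ t) : ‖deriv γ t‖ ≤ deriv Λ t := by
  have e1 := (hasDerivAt_iff_tendsto_slope.1 h1.hasDerivAt).norm
  have e2 := (hasDerivAt_iff_tendsto_slope.1 h2.hasDerivAt)
  have hle : nhdsWithin t (Ioi t) ≤ nhdsWithin t {t}ᶜ :=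
    nhdsWithin_mono _ fun s hs => ne_of_gt hs
  refine le_of_tendsto_of_tendsto (e1.mono_left hle) (e2.mono_left hle) ?_
  filter_upwards [self_mem_nhdsWithin] with s hs
  have hsr : 0 < s - t := sub_pos.2 hs
  rw [slope_def_module, slope_def_field, norm_smul, norm_inv, Real.norm_of_nonneg hsr.le,
    ← dist_eq_norm, dist_comm, inv_mul_eq_div]
  exact div_le_div_of_nonneg_right (h s (le_of_lt hs)) hsr.le

/-- The arc length function of a Lipschitz path. -/
lemma exists_arclength {γ : ℝ → V} {K : NNReal} (hγ : LipschitzWith K γ) :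
    ∃ Λ : ℝ → ℝ, LipschitzWith K Λ ∧ Monotone Λ ∧ (∀ s t, s ≤ t → dist (γ s) (γ t) ≤ Λ t - Λ s) ∧
      Λ 0 = 0 ∧ ∀ s t, s ≤ t → subarcLength γ s t = ENNReal.ofReal (Λ t - Λ s) := by
  have hvar : ∀ s t, s ≤ t → eVariationOn γ (Icc s t) ≤ ENNReal.ofReal (K * t - K * s) := by
    intro s t hst
    refine variation_le_of_edist_le (L := fun u => K * u) hst ?_ ?_
    · exact (fun p _ q _ hpq => mul_le_mul_of_nonneg_left hpq K.2)
    · intro p _ q _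
      rw [edist_dist, edist_dist]
      apply ENNReal.ofReal_le_ofReal
      refine (hγ.dist_le_mul p q).trans ?_
      rw [Real.dist_eq, Real.dist_eq, ← mul_sub, abs_mul, NNReal.abs_eq]
  have hfin : ∀ s t, s ≤ t → eVariationOn γ (Icc s t) ≠ ⊤ := fun s t hst =>
    ((hvar s t hst).trans_lt ENNReal.ofReal_lt_top).ne
  have hloc : LocallyBoundedVariationOn γ univ := hγ.locallyBoundedVariationOn univ
  have hsub : ∀ s t, s ≤ t → variationOnFromTo γ univ 0 t - variationOnFromTo γ univ 0 s
      = (eVariationOn γ (Icc s t)).toReal := by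
    intro s t hst
    rw [← variationOnFromTo.add hloc (mem_univ 0) (mem_univ s) (mem_univ t), add_sub_cancel_left,
      variationOnFromTo.eq_of_le _ _ hst, univ_inter]
  have hmono : Monotone (fun t => variationOnFromTo γ univ 0 t) := by
    intro s t hst
    have := hsub s t hst
    have h2 : 0 ≤ (eVariationOn γ (Icc s t)).toReal := ENNReal.toReal_nonneg
    simp only
    linarith
  have hlip : ∀ s t, s ≤ t → variationOnFromTo γ univ 0 t - variationOnFromTo γ univ 0 s
      ≤ K * (t - s) := by
    intro s t hst
    rw [hsub s t hst, mul_sub]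
    refine ENNReal.toReal_le_of_le_ofReal ?_ (hvar s t hst)
    rw [← mul_sub]
    exact mul_nonneg K.2 (sub_nonneg.2 hst)
  refine ⟨fun t => variationOnFromTo γ univ 0 t, ?_, hmono, ?_, ?_, ?_⟩
  · refine LipschitzWith.of_dist_le_mul fun s t => ?_
    rcases le_total s t with hst | hst
    · rw [dist_comm, Real.dist_eq, dist_comm, Real.dist_eq, abs_of_nonneg (sub_nonneg.2 (hmono hst)),
        abs_of_nonneg (sub_nonneg.2 hst)]
      exact hlip s t hst
    · rw [Real.dist_eq, Real.dist_eq, abs_of_nonneg (sub_nonneg.2 (hmono hst)),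
        abs_of_nonneg (sub_nonneg.2 hst)]
      exact hlip t s hst
  · intro s t hst
    rw [hsub s t hst, dist_edist]
    exact ENNReal.toReal_mono (hfin s t hst)
      (eVariationOn.edist_le γ (left_mem_Icc.2 hst) (right_mem_Icc.2 hst))
  · exact variationOnFromTo.self γ univ 0
  · intro s t hst
    rw [hsub s t hst, ENNReal.ofReal_toReal (hfin s t hst)]
    rfl

lemma log_one_add_mul_le {c s : ℝ} (hc : 1 ≤ c) (hs : 0 ≤ s) :
    Real.log (1 + c * s) ≤ c * Real.log (1 + s) := by
  rw [← Real.log_rpow (by linarith)]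
  apply Real.log_le_log (by nlinarith)
  exact one_add_mul_self_le_rpow_one_add (by linarith) hc

lemma jDist_eq {D : Set V} {x y : V} (hx : 0 < bdist D x) (hy : 0 < bdist D y) :
    jDist D x y = 1 / 2 * (Real.log (1 + dist x y / bdist D x) +
      Real.log (1 + dist x y / bdist D y)) := by
  have h1 : 0 ≤ dist x y / bdist D x := div_nonneg dist_nonneg hx.le
  have h2 : 0 ≤ dist x y / bdist D y := div_nonneg dist_nonneg hy.le
  rw [jDist, Real.log_mul (by linarith) (by linarith)]

lemma forward_dir [Nontrivial V] {D : Set V} (ho : IsOpen D) (hD : D ≠ univ)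
    (hb : Bornology.IsBounded D) (hu : IsUniformDomain D) :
    ∃ c₁ : ℝ, 1 ≤ c₁ ∧ ∀ x ∈ D, ∀ y ∈ D, mDist D x y ≤ c₁ * jDist D x y := by
  obtain ⟨c, hc, hu⟩ := hu
  refine ⟨2 * (1 + 2 * c) * (2 * c), by nlinarith, fun x hx y hy => ?_⟩
  obtain ⟨γ, hγ, hcone, hqc⟩ := hu x hx y hy
  refine (mDist_le ho hD hb hγ).trans ?_
  obtain ⟨⟨K, hK⟩, h0, h1, hin⟩ := hγ
  obtain ⟨Λ, hΛK, hΛm, hΛd, hΛ0, hΛs⟩ := exists_arclength hK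
  have ha := bdist_pos ho hD hx
  have hb' := bdist_pos ho hD hy
  set a := bdist D x
  set b := bdist D y
  set T := Λ 1 with hT
  have hT0 : 0 ≤ T := by rw [← hΛ0]; exact hΛm zero_le_one
  have hTr : T ≤ c * dist x y := by
    rw [hΛs 0 1 zero_le_one, hΛ0, sub_zero] at hqc
    exact (ENNReal.ofReal_le_ofReal_iff (mul_nonneg (by linarith) dist_nonneg)).1 hqc
  have hΛnn : ∀ t ∈ Icc (0:ℝ) 1, 0 ≤ Λ t := fun t ht => by rw [← hΛ0]; exact hΛm ht.1
  have hΛle : ∀ t ∈ Icc (0:ℝ) 1, Λ t ≤ T := fun t ht => hΛm ht.2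
  -- pointwise bound
  have hpt : ∀ t ∈ Icc (0:ℝ) 1,
      (bdist D (γ t))⁻¹ ≤ (1 + 2 * c) * ((a + Λ t)⁻¹ + (b + T - Λ t)⁻¹) := by
    intro t ht
    have hδ := bdist_pos ho hD (hin t ht)
    have hn := hΛnn t ht
    have hl := hΛle t ht
    have p1 : 0 < a + Λ t := by linarith
    have p2 : 0 < b + T - Λ t := by linarith
    have hcd : 0 ≤ c * bdist D (γ t) := mul_nonneg (by linarith) hδ.le
    have hd0 := hΛd 0 t ht.1
    rw [h0, hΛ0, sub_zero] at hd0
    have hd1 := hΛd t 1 ht.2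
    rw [h1, dist_comm] at hd1
    have ha1 : a ≤ bdist D (γ t) + dist x (γ t) := bdist_le_add D _ _
    have hb1 : b ≤ bdist D (γ t) + dist y (γ t) := bdist_le_add D _ _
    have key : ∀ p, 0 < p → p ≤ (1 + 2 * c) * bdist D (γ t) →
        (bdist D (γ t))⁻¹ ≤ (1 + 2 * c) * p⁻¹ := by
      intro p hp hle
      rw [← div_eq_mul_inv, inv_eq_one_div, div_le_div_iff₀ hδ hp]
      linarith
    have q1 : 0 ≤ (1 + 2 * c) * (a + Λ t)⁻¹ := mul_nonneg (by linarith) (inv_pos.2 p1).le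
    have q2 : 0 ≤ (1 + 2 * c) * (b + T - Λ t)⁻¹ := mul_nonneg (by linarith) (inv_pos.2 p2).le
    rw [mul_add]
    rcases min_le_iff.1 (hcone t ht) with h | h
    · rw [hΛs 0 t ht.1, hΛ0, sub_zero, ENNReal.ofReal_le_ofReal_iff hcd] at h
      have := key _ p1 (by linarith)
      linarith
    · rw [hΛs t 1 ht.2, ENNReal.ofReal_le_ofReal_iff hcd] at h
      have := key _ p2 (by linarith)
      linarith
  have l1 : LipschitzOnWith K (fun t => a + Λ t) (Icc 0 1) := by
    refine LipschitzWith.lipschitzOnWith (LipschitzWith.of_dist_le_mul fun s t => ?_)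
    rw [dist_add_left]; exact hΛK.dist_le_mul s t
  have l2 : LipschitzOnWith K (fun t => b + T - Λ t) (Icc 0 1) := by
    refine LipschitzWith.lipschitzOnWith (LipschitzWith.of_dist_le_mul fun s t => ?_)
    rw [dist_sub_left]; exact hΛK.dist_le_mul s t
  obtain ⟨K1, k1⟩ := log_lip ha l1 (fun t ht => by have := hΛnn t ht; linarith)
  obtain ⟨K2, k2⟩ := log_lip hb' l2 (fun t ht => by have := hΛle t ht; linarith)
  have hC : 0 < 2 * (1 + 2 * c) := by linarith
  have main := ftc_ge (g := fun t => Real.log (a + Λ t) - Real.log (b + T - Λ t))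
    (h := fun t => (2 * (1 + 2 * c))⁻¹ * (mDensity D (γ t) * ‖deriv γ t‖)) (K := K1 + K2)
    zero_le_one (by
      refine LipschitzOnWith.of_dist_le_mul fun s hs t ht => ?_
      have e1 := k1.dist_le_mul s hs t ht
      have e2 := k2.dist_le_mul s hs t ht
      refine (dist_sub_sub_le _ _ _ _).trans ?_
      push_cast
      linarith)
    ((m_integrable ho hD hb hK hin (left_mem_Icc.2 zero_le_one)
      (right_mem_Icc.2 zero_le_one)).const_mul _) (by
      filter_upwards [hK.ae_differentiableAt_real, hΛK.ae_differentiableAt_real] with t d1 d2 ht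
      have ht' : t ∈ Icc (0:ℝ) 1 := Ioo_subset_Icc_self ht
      have hn := hΛnn t ht'
      have hl := hΛle t ht'
      have p1 : 0 < a + Λ t := by linarith
      have p2 : 0 < b + T - Λ t := by linarith
      have hder : HasDerivAt (fun t => Real.log (a + Λ t) - Real.log (b + T - Λ t))
          (deriv Λ t / (a + Λ t) - (-deriv Λ t) / (b + T - Λ t)) t :=
        ((d2.hasDerivAt.const_add a).log p1.ne').sub ((d2.hasDerivAt.const_sub (b + T)).log p2.ne')
      rw [hder.deriv]
      have hsp := norm_deriv_le_deriv (fun s hs => hΛd t s hs) d1 d2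
      have m1 := mDensity_le ho hD hb (hin t ht')
      have m2 := hpt t ht'
      have m3 : mDensity D (γ t) ≤ 2 * (1 + 2 * c) * ((a + Λ t)⁻¹ + (b + T - Λ t)⁻¹) := by linarith
      have hS : 0 ≤ (a + Λ t)⁻¹ + (b + T - Λ t)⁻¹ := by positivity
      rw [inv_mul_le_iff₀ hC]
      calc mDensity D (γ t) * ‖deriv γ t‖
          ≤ (2 * (1 + 2 * c) * ((a + Λ t)⁻¹ + (b + T - Λ t)⁻¹)) * deriv Λ t :=
            mul_le_mul m3 hsp (norm_nonneg _) (mul_nonneg hC.le hS)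
        _ = _ := by ring)
  rw [intervalIntegral.integral_const_mul, inv_mul_le_iff₀ hC] at main
  refine le_trans main ?_
  rw [mul_assoc (2 * (1 + 2 * c)) (2 * c)]
  apply mul_le_mul_of_nonneg_left _ hC.le
  rw [jDist_eq ha hb', hΛ0, ← hT]
  have e : ∀ p, 0 < p → Real.log (p + T) - Real.log p ≤ c * Real.log (1 + dist x y / p) := by
    intro p hp
    rw [← Real.log_div (by linarith) hp.ne']
    refine le_trans ?_ (log_one_add_mul_le hc (div_nonneg dist_nonneg hp.le))
    apply Real.log_le_log (by positivity)
    rw [add_div, div_self hp.ne', ← mul_div_assoc]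
    have := div_le_div_of_nonneg_right hTr hp.le
    linarith
  have e1 := e a ha
  have e2 := e b hb'
  have e3 : b + T - T = b := by ring
  rw [e3, add_zero, sub_zero]
  linarith

end Geometry

/-! ### Abstract real-variable form of the Gehring–Osgood argument -/

lemma first_hit {f : ℝ → ℝ} {a b v : ℝ} (hab : a ≤ b) (hf : ContinuousOn f (Icc a b))
    (ha : f a ≤ v) (hb : v ≤ f b) :
    ∃ s ∈ Icc a b, f s = v ∧ ∀ u ∈ Icc a s, f u ≤ v := by
  have hcl : IsCompact (Icc a b ∩ f ⁻¹' (Ici v)) :=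
    isCompact_Icc.of_isClosed_subset (hf.preimage_isClosed_of_isClosed isClosed_Icc isClosed_Ici)
      inter_subset_left
  obtain ⟨s, ⟨hs, hsv⟩, hmin⟩ := hcl.exists_isLeast ⟨b, right_mem_Icc.2 hab, hb⟩
  have hlt : ∀ u ∈ Icc a b, u < s → f u < v := by
    intro u hu hus
    by_contra h
    exact absurd (hmin ⟨hu, not_lt.1 h⟩) (not_le.2 hus)
  have hfs : f s = v := by
    obtain ⟨u, hu, huv⟩ := intermediate_value_Icc hs.1 (hf.mono (Icc_subset_Icc_right hs.2))
      ⟨ha, hsv⟩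
    have hus : s ≤ u := hmin ⟨⟨hu.1, hu.2.trans hs.2⟩, huv.ge⟩
    rw [le_antisymm hus hu.2]; exact huv
  refine ⟨s, hs, hfs, fun u hu => ?_⟩
  rcases eq_or_lt_of_le hu.2 with h | h
  · rw [h, hfs]
  · exact (hlt u ⟨hu.1, hu.2.trans hs.2⟩ h).le

/-- The constant bounding normalized length. -/
noncomputable def goA (c : ℝ) : ℝ := 2 * c * Real.log (4 * c) + 3

/-- The constant bounding quasihyperbolic length. -/
noncomputable def goB (c : ℝ) : ℝ := c * Real.log (1 + 2 * goA c) + 1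

/-- The cone constant. -/
noncomputable def goC (c : ℝ) : ℝ := 3 * goA c * Real.exp (goB c)

lemma goA_pos {c : ℝ} (hc : 1 ≤ c) : 0 < goA c := by
  have : 0 ≤ Real.log (4 * c) := Real.log_nonneg (by linarith)
  unfold goA; positivity

lemma goB_pos {c : ℝ} (hc : 1 ≤ c) : 0 < goB c := by
  have h := goA_pos hc
  have : 0 ≤ Real.log (1 + 2 * goA c) := Real.log_nonneg (by linarith)
  unfold goB; positivity

lemma goC_pos {c : ℝ} (hc : 1 ≤ c) : 0 < goC c := by
  have h := goA_pos hc
  unfold goC; positivity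

lemma le_goA {c a : ℝ} (hc : 1 ≤ c) (ha : 0 ≤ a) (h : a ≤ c * Real.log (1 + 2 * a) + 1) :
    a ≤ goA c := by
  have h4 : 0 < 4 * c := by linarith
  have h1 := Real.log_le_sub_one_of_pos (x := (1 + 2 * a) / (4 * c)) (by positivity)
  rw [Real.log_div (by linarith) h4.ne'] at h1
  have h2 : c * ((1 + 2 * a) / (4 * c)) = (1 + 2 * a) / 4 := by field_simp
  have h3 := mul_le_mul_of_nonneg_left h1 (by linarith : 0 ≤ c)
  rw [mul_sub, mul_sub, h2] at h3
  unfold goA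
  linarith

section Abstract

variable {c T : ℝ} {d L k : ℝ → ℝ}

lemma go_key1 (hc : 1 ≤ c)
    (hLm : MonotoneOn L (Icc 0 T))
    (H1 : ∀ s t M, 0 ≤ s → s ≤ t → t ≤ T → (∀ u ∈ Icc s t, d u ≤ M) → L t - L s ≤ M * (k t - k s))
    (H3 : ∀ s t m, 0 ≤ s → s ≤ t → t ≤ T → 0 < m → m ≤ d s → m ≤ d t →
      k t - k s ≤ c * Real.log (1 + (L t - L s) / m) + 1)
    {s t M : ℝ} (hs : 0 ≤ s) (hst : s ≤ t) (ht : t ≤ T) (hM : 0 < M)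
    (hle : ∀ u ∈ Icc s t, d u ≤ M) (h1 : M / 2 ≤ d s) (h2 : M / 2 ≤ d t) :
    L t - L s ≤ goA c * M ∧ k t - k s ≤ goB c := by
  have e1 := H1 s t M hs hst ht hle
  have e2 := H3 s t (M / 2) hs hst ht (by linarith) h1 h2
  have hL : 0 ≤ L t - L s := sub_nonneg.2 (hLm ⟨hs, hst.trans ht⟩ ⟨hs.trans hst, ht⟩ hst)
  set a := (L t - L s) / M with ha
  have ha0 : 0 ≤ a := div_nonneg hL hM.le
  have e3 : (L t - L s) / (M / 2) = 2 * a := by rw [ha]; field_simp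
  rw [e3] at e2
  have e4 : a ≤ k t - k s := by rw [ha, div_le_iff₀ hM]; linarith
  have e5 := le_goA hc ha0 (e4.trans e2)
  refine ⟨?_, e2.trans ?_⟩
  · have : a * M = L t - L s := by rw [ha]; field_simp
    rw [← this]; exact mul_le_mul_of_nonneg_right e5 hM.le
  · unfold goB
    have : Real.log (1 + 2 * a) ≤ Real.log (1 + 2 * goA c) :=
      Real.log_le_log (by linarith) (by linarith)
    have := mul_le_mul_of_nonneg_left this (by linarith : 0 ≤ c)
    linarith

lemma go_key2 (hc : 1 ≤ c) (hd : ContinuousOn d (Icc 0 T)) (hpos : ∀ t ∈ Icc 0 T, 0 < d t)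
    (hLm : MonotoneOn L (Icc 0 T))
    (H1 : ∀ s t M, 0 ≤ s → s ≤ t → t ≤ T → (∀ u ∈ Icc s t, d u ≤ M) → L t - L s ≤ M * (k t - k s))
    (H3 : ∀ s t m, 0 ≤ s → s ≤ t → t ≤ T → 0 < m → m ≤ d s → m ≤ d t →
      k t - k s ≤ c * Real.log (1 + (L t - L s) / m) + 1) (n : ℕ) :
    ∀ t ∈ Icc 0 T, (∀ u ∈ Icc 0 t, d u ≤ d t) → d t ≤ 2 ^ n * d 0 →
      L t - L 0 ≤ 2 * goA c * d t := by
  have hA := goA_pos hc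
  have base : ∀ t ∈ Icc 0 T, (∀ u ∈ Icc 0 t, d u ≤ d t) → d t / 2 ≤ d 0 →
      L t - L 0 ≤ 2 * goA c * d t := by
    intro t ht hu h0
    have hp := hpos t ht
    have := (go_key1 hc hLm H1 H3 le_rfl ht.1 ht.2 hp hu h0 (by linarith)).1
    nlinarith [mul_pos hA hp]
  induction n with
  | zero =>
    intro t ht hu h
    have hp := hpos t ht
    refine base t ht hu ?_
    simp only [pow_zero, one_mul] at h
    linarith
  | succ n ih =>
    intro t ht hu h
    by_cases h0 : d t / 2 ≤ d 0
    · exact base t ht hu h0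
    have hp := hpos t ht
    obtain ⟨s, hs, hsv, hsu⟩ := first_hit (v := d t / 2) ht.1
      (hd.mono (Icc_subset_Icc_right ht.2)) (not_le.1 h0).le (by linarith)
    have e1 := ih s ⟨hs.1, hs.2.trans ht.2⟩ (fun u hu' => by rw [hsv]; exact hsu u hu') (by
      rw [hsv]; rw [pow_succ] at h; linarith)
    have e2 := (go_key1 hc hLm H1 H3 hs.1 hs.2 ht.2 hp
      (fun u hu' => hu u ⟨hs.1.trans hu'.1, hu'.2⟩) hsv.ge (by linarith)).1
    rw [hsv] at e1
    linarith

lemma go_half (hc : 1 ≤ c) (hd : ContinuousOn d (Icc 0 T)) (hpos : ∀ t ∈ Icc 0 T, 0 < d t)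
    (hLm : MonotoneOn L (Icc 0 T)) (hkm : MonotoneOn k (Icc 0 T))
    (H1 : ∀ s t M, 0 ≤ s → s ≤ t → t ≤ T → (∀ u ∈ Icc s t, d u ≤ M) → L t - L s ≤ M * (k t - k s))
    (H2 : ∀ s t, 0 ≤ s → s ≤ t → t ≤ T → Real.log (d s) - Real.log (d t) ≤ k t - k s)
    (H3 : ∀ s t m, 0 ≤ s → s ≤ t → t ≤ T → 0 < m → m ≤ d s → m ≤ d t →
      k t - k s ≤ c * Real.log (1 + (L t - L s) / m) + 1)
    (hmax : ∀ t ∈ Icc 0 T, d t ≤ d T) :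
    ∀ t ∈ Icc 0 T, L t - L 0 ≤ goC c * d t := by
  intro t ht
  have hA := goA_pos hc
  obtain ⟨s, hs, hsmax⟩ := isCompact_Icc.exists_isMaxOn (nonempty_Icc.2 ht.1)
    (hd.mono (Icc_subset_Icc_right ht.2))
  have hsT : s ∈ Icc 0 T := ⟨hs.1, hs.2.trans ht.2⟩
  have h0 : (0:ℝ) ∈ Icc 0 T := ⟨le_rfl, ht.1.trans ht.2⟩
  have hM := hpos s hsT
  have hsm : ∀ u ∈ Icc 0 t, d u ≤ d s := fun u hu => hsmax hu
  obtain ⟨t', ht', htv, htu⟩ := first_hit (v := d s) ht.2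
    (hd.mono (Icc_subset_Icc_left ht.1)) (hsm t (right_mem_Icc.2 ht.1)) (hmax s hsT)
  obtain ⟨e1, e2⟩ := go_key1 hc hLm H1 H3 hs.1 (hs.2.trans ht'.1) ht'.2 hM (fun u hu => by
    rcases le_total u t with h | h
    · exact hsm u ⟨hs.1.trans hu.1, h⟩
    · exact htu u ⟨h, hu.2⟩) (by linarith) (by linarith)
  obtain ⟨n, hn⟩ := pow_unbounded_of_one_lt (d s / d 0) (one_lt_two : (1:ℝ) < 2)
  have e3 := go_key2 hc hd hpos hLm H1 H3 n s hsT
    (fun u hu => hsm u ⟨hu.1, hu.2.trans hs.2⟩) ((div_le_iff₀ (hpos 0 h0)).1 hn.le)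
  have htT' : t' ∈ Icc 0 T := ⟨ht.1.trans ht'.1, ht'.2⟩
  have e4 : L t ≤ L t' := hLm ht htT' ht'.1
  have e5 : k t ≤ k t' := hkm ht htT' ht'.1
  have e6 := H2 s t hs.1 hs.2 ht.2
  have hdt := hpos t ht
  have e7 : d s ≤ Real.exp (goB c) * d t := by
    have : Real.log (d s) ≤ goB c + Real.log (d t) := by linarith
    rwa [Real.log_le_iff_le_exp hM, Real.exp_add, Real.exp_log hdt] at this
  have e8 : L t - L 0 ≤ 3 * goA c * d s := by linarith
  refine e8.trans ?_
  unfold goC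
  have := mul_le_mul_of_nonneg_left e7 (by linarith : 0 ≤ 3 * goA c)
  linarith

end Abstract

/-- The quasi-convexity constant. -/
noncomputable def goQ (c : ℝ) : ℝ :=
  4 * goC c * Real.exp (c * Real.log (1 + (1 + 4 * goC c) / 2) + 1)

lemma go_full {c : ℝ} {d L k : ℝ → ℝ} {Δ : ℝ → ℝ → ℝ} {r : ℝ} (hc : 1 ≤ c)
    (hd : ContinuousOn d (Icc 0 1)) (hpos : ∀ t ∈ Icc (0:ℝ) 1, 0 < d t)
    (hLm : MonotoneOn L (Icc 0 1)) (hkm : MonotoneOn k (Icc 0 1))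
    (H1 : ∀ s t M, 0 ≤ s → s ≤ t → t ≤ 1 → (∀ u ∈ Icc s t, d u ≤ M) → L t - L s ≤ M * (k t - k s))
    (H2 : ∀ s t, 0 ≤ s → s ≤ t → t ≤ 1 → |Real.log (d s) - Real.log (d t)| ≤ k t - k s)
    (H3 : ∀ s t m, 0 ≤ s → s ≤ t → t ≤ 1 → 0 < m → m ≤ d s → m ≤ d t →
      k t - k s ≤ c * Real.log (1 + Δ s t / m) + 1)
    (HΔ0 : ∀ s t, 0 ≤ Δ s t)
    (HΔ1 : ∀ s t, 0 ≤ s → s ≤ t → t ≤ 1 → Δ s t ≤ L t - L s)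
    (HΔ2 : ∀ s t, 0 ≤ s → s ≤ t → t ≤ 1 → Δ s t ≤ r + (L s - L 0) + (L 1 - L t))
    (hr : 0 < r) (hd0 : d 0 ≤ 2 * r) (hd1 : d 1 ≤ 2 * r) :
    (∀ t ∈ Icc (0:ℝ) 1, min (L t - L 0) (L 1 - L t) ≤ goC c * d t) ∧
      L 1 - L 0 ≤ goQ c * r := by
  have hC := goC_pos hc
  obtain ⟨t0, ht0, hmax⟩ := isCompact_Icc.exists_isMaxOn (nonempty_Icc.2 (zero_le_one' ℝ)) hd
  have hmx : ∀ u ∈ Icc (0:ℝ) 1, d u ≤ d t0 := fun u hu => hmax hu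
  have H3' : ∀ s t m, 0 ≤ s → s ≤ t → t ≤ 1 → 0 < m → m ≤ d s → m ≤ d t →
      k t - k s ≤ c * Real.log (1 + (L t - L s) / m) + 1 := by
    intro s t m hs hst ht hm h1 h2
    refine (H3 s t m hs hst ht hm h1 h2).trans ?_
    have e1 : Δ s t / m ≤ (L t - L s) / m := div_le_div_of_nonneg_right (HΔ1 s t hs hst ht) hm.le
    have e0 : 0 ≤ Δ s t / m := div_nonneg (HΔ0 s t) hm.le
    have e2 : Real.log (1 + Δ s t / m) ≤ Real.log (1 + (L t - L s) / m) :=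
      Real.log_le_log (by linarith) (by linarith)
    have := mul_le_mul_of_nonneg_left e2 (by linarith : 0 ≤ c)
    linarith
  have half1 : ∀ t ∈ Icc 0 t0, L t - L 0 ≤ goC c * d t := by
    have hsub : Icc 0 t0 ⊆ Icc (0:ℝ) 1 := Icc_subset_Icc_right ht0.2
    refine go_half (k := k) hc (hd.mono hsub) (fun t ht => hpos t (hsub ht)) (hLm.mono hsub)
      (hkm.mono hsub) (fun s t M h1 h2 h3 => H1 s t M h1 h2 (h3.trans ht0.2))
      (fun s t h1 h2 h3 => (le_abs_self _).trans (H2 s t h1 h2 (h3.trans ht0.2)))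
      (fun s t m h1 h2 h3 => H3' s t m h1 h2 (h3.trans ht0.2)) (fun t ht => hmx t (hsub ht))
  have half2 : ∀ t ∈ Icc t0 1, L 1 - L t ≤ goC c * d t := by
    have hmem : ∀ u ∈ Icc 0 (1 - t0), 1 - u ∈ Icc (0:ℝ) 1 := fun u hu =>
      ⟨by linarith [hu.2, ht0.1], by linarith [hu.1]⟩
    have := go_half (c := c) (T := 1 - t0) (d := fun u => d (1 - u)) (L := fun u => - L (1 - u))
      (k := fun u => - k (1 - u)) hc
      (hd.comp (continuousOn_const.sub continuousOn_id) hmem)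
      (fun t ht => hpos _ (hmem t ht))
      (fun s hs t ht hst => neg_le_neg (hLm (hmem t ht) (hmem s hs) (by linarith)))
      (fun s hs t ht hst => neg_le_neg (hkm (hmem t ht) (hmem s hs) (by linarith)))
      (fun s t M h1 h2 h3 hM => by
        have := H1 (1 - t) (1 - s) M (by linarith [ht0.1]) (by linarith) (by linarith)
          (fun u hu => by
            have := hM (1 - u) ⟨by linarith [hu.2], by linarith [hu.1]⟩
            simpa using this)
        have e1 : -L (1 - t) - -L (1 - s) = L (1 - s) - L (1 - t) := by ring
        have e2 : -k (1 - t) - -k (1 - s) = k (1 - s) - k (1 - t) := by ring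
        simp only [e1, e2]; exact this)
      (fun s t h1 h2 h3 => by
        have := H2 (1 - t) (1 - s) (by linarith [ht0.1]) (by linarith) (by linarith)
        rw [abs_sub_comm] at this
        have := (le_abs_self _).trans this
        linarith)
      (fun s t m h1 h2 h3 hm hs ht => by
        have := H3' (1 - t) (1 - s) m (by linarith [ht0.1]) (by linarith) (by linarith) hm ht hs
        have e1 : -L (1 - t) - -L (1 - s) = L (1 - s) - L (1 - t) := by ring
        have e2 : -k (1 - t) - -k (1 - s) = k (1 - s) - k (1 - t) := by ring
        simp only [e1, e2]; exact this)
      (fun t ht => by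
        have := hmx _ (hmem t ht)
        simpa using this)
    intro t ht
    have h := this (1 - t) ⟨by linarith [ht.2], by linarith [ht.1]⟩
    simp only [sub_sub_cancel, sub_zero] at h
    linarith
  refine ⟨fun t ht => ?_, ?_⟩
  · rcases le_total t t0 with h | h
    · exact (min_le_left _ _).trans (half1 t ⟨ht.1, h⟩)
    · exact (min_le_right _ _).trans (half2 t ⟨h, ht.2⟩)
  · have q1 := half1 t0 (right_mem_Icc.2 ht0.1)
    have q2 := half2 t0 (left_mem_Icc.2 ht0.2)
    set B := c * Real.log (1 + (1 + 4 * goC c) / 2) + 1 with hB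
    have hB0 : 0 ≤ B := by
      have : 0 ≤ Real.log (1 + (1 + 4 * goC c) / 2) := Real.log_nonneg (by linarith)
      positivity
    have hE : 1 ≤ Real.exp B := Real.one_le_exp hB0
    have suff : d t0 ≤ 2 * Real.exp B * r := by
      by_cases hcase : d t0 ≤ 2 * r
      · nlinarith
      have hcase' := (not_le.1 hcase).le
      obtain ⟨s, hs, hsv, -⟩ := first_hit (v := 2 * r) ht0.1
        (hd.mono (Icc_subset_Icc_right ht0.2)) hd0 hcase'
      obtain ⟨t, ht, htv⟩ := intermediate_value_Icc' ht0.2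
        (hd.mono (Icc_subset_Icc_left ht0.1)) ⟨hd1, hcase'⟩
      have hs1 := half1 s hs
      have ht1 := half2 t ht
      rw [hsv] at hs1
      rw [htv] at ht1
      have hΔ := HΔ2 s t hs.1 (hs.2.trans ht.1) ht.2
      have h3 := H3 s t (2 * r) hs.1 (hs.2.trans ht.1) ht.2 (by linarith) hsv.ge htv.ge
      have h4 : Δ s t / (2 * r) ≤ (1 + 4 * goC c) / 2 := by
        rw [div_le_div_iff₀ (by linarith) two_pos]
        linarith
      have h5 : 0 ≤ Δ s t / (2 * r) := div_nonneg (HΔ0 s t) (by linarith)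
      have h6 : Real.log (1 + Δ s t / (2 * r)) ≤ Real.log (1 + (1 + 4 * goC c) / 2) :=
        Real.log_le_log (by linarith) (by linarith)
      have h7 := mul_le_mul_of_nonneg_left h6 (by linarith : 0 ≤ c)
      have h8 : k t - k s ≤ B := by rw [hB]; linarith
      have h9 : k t0 ≤ k t := hkm ht0 ⟨ht0.1.trans ht.1, ht.2⟩ ht.1
      have h10 := H2 s t0 hs.1 hs.2 ht0.2
      rw [abs_sub_comm, hsv] at h10
      have h11 := (le_abs_self _).trans h10
      have h12 : Real.log (d t0) ≤ B + Real.log (2 * r) := by linarith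
      have hp := hpos t0 ht0
      rw [Real.log_le_iff_le_exp hp, Real.exp_add, Real.exp_log (by linarith)] at h12
      linarith
    have := mul_le_mul_of_nonneg_left suff hC.le
    unfold goQ
    rw [← hB]
    linarith

/-! ### Concatenation and restriction of paths -/

section Paths

set_option linter.unusedSectionVars false

variable {V : Type*} [NormedAddCommGroup V] [InnerProductSpace ℝ V] [FiniteDimensional ℝ V]

lemma integral_reparam (ρ : V → ℝ) {σ γ : ℝ → V} {p q c e : ℝ} (hpq : p ≤ q) (hc : 0 ≤ c)
    (h : ∀ t ∈ Ioo p q, σ t = γ (e + c * t)) :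
    ∫ t in p..q, ρ (σ t) * ‖deriv σ t‖ = ∫ t in (e + c * p)..(e + c * q), ρ (γ t) * ‖deriv γ t‖ := by
  rw [← intervalIntegral.smul_integral_comp_add_mul, smul_eq_mul,
    ← intervalIntegral.integral_const_mul]
  refine intervalIntegral.integral_congr_Ioo_of_le hpq fun t ht => ?_
  have he : σ =ᶠ[nhds t] fun t => γ (e + c * t) :=
    Filter.eventuallyEq_of_mem (Ioo_mem_nhds ht.1 ht.2) h
  have hder : deriv σ t = c • deriv γ (e + c * t) := by
    rw [he.deriv_eq]
    have := deriv_comp_mul_left (𝕜 := ℝ) c (fun u => γ (e + u)) t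
    rw [deriv_comp_const_add] at this
    exact this
  rw [hder, h t ht, norm_smul, Real.norm_of_nonneg hc]
  ring

lemma rect_sub {D : Set V} {x y : V} {γ : ℝ → V} (hγ : IsRectPathIn D x y γ) {s t : ℝ}
    (hs : 0 ≤ s) (hst : s ≤ t) (ht : t ≤ 1) (ρ : V → ℝ) :
    ∃ σ, IsRectPathIn D (γ s) (γ t) σ ∧
      pathIntegral ρ σ = ∫ u in s..t, ρ (γ u) * ‖deriv γ u‖ := by
  obtain ⟨⟨K, hK⟩, h0, h1, hin⟩ := hγ
  refine ⟨fun u => γ (s + (t - s) * u), ⟨⟨K * (t - s).toNNReal, ?_⟩, ?_, ?_, ?_⟩, ?_⟩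
  · refine hK.comp (LipschitzWith.of_dist_le_mul fun p q => ?_)
    rw [dist_add_left, Real.dist_eq, Real.dist_eq, ← mul_sub, abs_mul,
      Real.coe_toNNReal _ (sub_nonneg.2 hst), abs_of_nonneg (sub_nonneg.2 hst)]
  · simp
  · simp
  · intro u hu
    apply hin
    have h1 : 0 ≤ (t - s) * u := mul_nonneg (sub_nonneg.2 hst) hu.1
    have h2 : (t - s) * u ≤ (t - s) * 1 := mul_le_mul_of_nonneg_left hu.2 (sub_nonneg.2 hst)
    constructor <;> linarith
  · unfold pathIntegral
    rw [integral_reparam (γ := γ) (c := t - s) (e := s) ρ zero_le_one (sub_nonneg.2 hst)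
      (fun _ _ => rfl)]
    simp

lemma rect_trans {D : Set V} {x y z : V} {γ₁ γ₂ : ℝ → V} (h1 : IsRectPathIn D x y γ₁)
    (h2 : IsRectPathIn D y z γ₂) :
    ∃ γ, IsRectPathIn D x z γ ∧ (∀ t, t ≤ 1 / 2 → γ t = γ₁ (2 * t)) ∧
      (∀ t, 1 / 2 ≤ t → γ t = γ₂ (-1 + 2 * t)) := by
  obtain ⟨⟨K, hK⟩, a0, a1, ain⟩ := h1
  obtain ⟨⟨K', hK'⟩, b0, b1, bin⟩ := h2
  have e1 : ∀ t : ℝ, t ≤ 1 / 2 →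
      γ₁ (min (2 * t) 1) + (γ₂ (max (-1 + 2 * t) 0) - y) = γ₁ (2 * t) := by
    intro t ht
    rw [min_eq_left (by linarith), max_eq_right (by linarith), b0]; abel
  have e2 : ∀ t : ℝ, 1 / 2 ≤ t →
      γ₁ (min (2 * t) 1) + (γ₂ (max (-1 + 2 * t) 0) - y) = γ₂ (-1 + 2 * t) := by
    intro t ht
    rw [min_eq_right (by linarith), max_eq_left (by linarith), a1]; abel
  refine ⟨fun t => γ₁ (min (2 * t) 1) + (γ₂ (max (-1 + 2 * t) 0) - y), ⟨?_, ?_, ?_, ?_⟩, e1, e2⟩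
  · have m2 : LipschitzWith 2 (fun t : ℝ => 2 * t) := LipschitzWith.of_dist_le_mul fun p q => by
      rw [Real.dist_eq, Real.dist_eq, ← mul_sub, abs_mul]; norm_num
    have m3 : LipschitzWith 2 (fun t : ℝ => -1 + 2 * t) := LipschitzWith.of_dist_le_mul fun p q => by
      rw [dist_add_left]; exact m2.dist_le_mul p q
    have l1 := hK.comp (m2.min_const 1)
    have l2 := hK'.comp (m3.max_const 0)
    have l3 : LipschitzWith (K' * 2) (fun t : ℝ => γ₂ (max (-1 + 2 * t) 0) - y) :=
      LipschitzWith.of_dist_le_mul fun p q => by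
        rw [dist_sub_right]; exact l2.dist_le_mul p q
    exact ⟨_, l1.add l3⟩
  · simp only
    rw [e1 0 (by norm_num), mul_zero, a0]
  · simp only
    rw [e2 1 (by norm_num), ← b1]; norm_num
  · intro t ht
    simp only
    rcases le_total t (1 / 2) with h | h
    · rw [e1 t h]; exact ain _ ⟨by linarith [ht.1], by linarith⟩
    · rw [e2 t h]; exact bin _ ⟨by linarith, by linarith [ht.2]⟩

lemma mDist_trans [Nontrivial V] {D : Set V} (ho : IsOpen D) (hD : D ≠ univ)
    (hb : Bornology.IsBounded D) {x y z : V} {γ₁ γ₂ : ℝ → V} (h1 : IsRectPathIn D x y γ₁)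
    (h2 : IsRectPathIn D y z γ₂) :
    ∃ γ, IsRectPathIn D x z γ ∧ pathIntegral (mDensity D) γ =
      pathIntegral (mDensity D) γ₁ + pathIntegral (mDensity D) γ₂ := by
  obtain ⟨γ, hγ, e1, e2⟩ := rect_trans h1 h2
  refine ⟨γ, hγ, ?_⟩
  obtain ⟨⟨K, hK⟩, -, -, hin⟩ := hγ
  have m0 : (0:ℝ) ∈ Icc (0:ℝ) 1 := by simp
  have m1 : (1:ℝ) ∈ Icc (0:ℝ) 1 := by simp
  have mh : (1/2:ℝ) ∈ Icc (0:ℝ) 1 := by constructor <;> norm_num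
  unfold pathIntegral
  rw [← intervalIntegral.integral_add_adjacent_intervals
    (m_integrable ho hD hb hK hin m0 mh) (m_integrable ho hD hb hK hin mh m1),
    integral_reparam (γ := γ₁) (c := 2) (e := 0) _ (by norm_num) two_pos.le
      (fun t ht => by rw [zero_add]; exact e1 t ht.2.le),
    integral_reparam (γ := γ₂) (c := 2) (e := -1) _ (by norm_num) two_pos.le
      (fun t ht => e2 t ht.1.le)]
  norm_num

lemma rect_segment {D : Set V} {x y : V} (h : segment ℝ x y ⊆ D) :
    IsRectPathIn D x y (AffineMap.lineMap x y : ℝ → V) := by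
  refine ⟨⟨_, lipschitzWith_lineMap x y⟩, by simp, by simp, fun t ht => h ?_⟩
  rw [segment_eq_image_lineMap]
  exact ⟨t, ht, rfl⟩

lemma rect_exists {D : Set V} (ho : IsOpen D) (hc : IsPreconnected D) {x y : V} (hx : x ∈ D)
    (hy : y ∈ D) : ∃ γ, IsRectPathIn D x y γ := by
  have hball : ∀ w ∈ D, ∃ ε > 0, ∀ p ∈ ball w ε, ∀ q ∈ ball w ε,
      p ∈ D ∧ ∃ γ, IsRectPathIn D p q γ := by
    intro w hw
    obtain ⟨ε, hε, hsub⟩ := Metric.isOpen_iff.1 ho w hw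
    refine ⟨ε, hε, fun p hp q hq => ⟨hsub hp, _, rect_segment ?_⟩⟩
    exact ((convex_ball w ε).segment_subset hp hq).trans hsub
  have hS : IsOpen {z | z ∈ D ∧ ∃ γ, IsRectPathIn D x z γ} := by
    rw [Metric.isOpen_iff]
    rintro w ⟨hw, γ, hγ⟩
    obtain ⟨ε, hε, hb⟩ := hball w hw
    refine ⟨ε, hε, fun p hp => ⟨(hb p hp p hp).1, ?_⟩⟩
    obtain ⟨σ, hσ⟩ := (hb w (mem_ball_self hε) p hp).2
    obtain ⟨τ, hτ, -⟩ := rect_trans hγ hσ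
    exact ⟨τ, hτ⟩
  have hS' : IsOpen {z | z ∈ D ∧ ¬ ∃ γ, IsRectPathIn D x z γ} := by
    rw [Metric.isOpen_iff]
    rintro w ⟨hw, hn⟩
    obtain ⟨ε, hε, hb⟩ := hball w hw
    refine ⟨ε, hε, fun p hp => ⟨(hb p hp p hp).1, ?_⟩⟩
    rintro ⟨γ, hγ⟩
    obtain ⟨σ, hσ⟩ := (hb p hp w (mem_ball_self hε)).2
    obtain ⟨τ, hτ, -⟩ := rect_trans hγ hσ
    exact hn ⟨τ, hτ⟩
  have hsub := IsPreconnected.subset_left_of_subset_union hS hS'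
    (Set.disjoint_left.2 fun z h1 h2 => h2.2 h1.2)
    (fun z hz => by
      by_cases h : ∃ γ, IsRectPathIn D x z γ
      · exact Or.inl ⟨hz, h⟩
      · exact Or.inr ⟨hz, h⟩)
    ⟨x, hx, hx, _, rect_segment (by rw [segment_same]; exact singleton_subset_iff.2 hx)⟩ hc
  exact (hsub hy).2

/-- A path that minimizes the m-length up to `1`, together with its subarcs. -/
lemma near_geodesic [Nontrivial V] {D : Set V} (ho : IsOpen D) (hD : D ≠ univ)
    (hb : Bornology.IsBounded D) (hc : IsPreconnected D) {x y : V} (hx : x ∈ D) (hy : y ∈ D) :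
    ∃ γ, IsRectPathIn D x y γ ∧ ∀ s t, 0 ≤ s → s ≤ t → t ≤ 1 →
      ∫ u in s..t, mDensity D (γ u) * ‖deriv γ u‖ ≤ mDist D (γ s) (γ t) + 1 := by
  obtain ⟨γ0, hγ0⟩ := rect_exists ho hc hx hy
  obtain ⟨_, ⟨γ, hγ, rfl⟩, hlt⟩ := exists_lt_of_csInf_lt
    (s := pathIntegral (mDensity D) '' {γ | IsRectPathIn D x y γ}) ⟨_, γ0, hγ0, rfl⟩
    (lt_add_one (mDist D x y))
  refine ⟨γ, hγ, fun s t hs hst ht => ?_⟩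
  have hγ' := hγ
  obtain ⟨⟨K, hK⟩, h0, h1, hin⟩ := hγ'
  have ms : s ∈ Icc (0:ℝ) 1 := ⟨hs, hst.trans ht⟩
  have mt : t ∈ Icc (0:ℝ) 1 := ⟨hs.trans hst, ht⟩
  have m0 : (0:ℝ) ∈ Icc (0:ℝ) 1 := by simp
  have m1 : (1:ℝ) ∈ Icc (0:ℝ) 1 := by simp
  obtain ⟨α, hα, eα⟩ := rect_sub hγ le_rfl hs (hst.trans ht) (mDensity D)
  obtain ⟨β, hβ, eβ⟩ := rect_sub hγ (hs.trans hst) ht le_rfl (mDensity D)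
  rw [h0] at hα
  rw [h1] at hβ
  have hsplit : pathIntegral (mDensity D) γ = (∫ u in (0:ℝ)..s, mDensity D (γ u) * ‖deriv γ u‖) +
      (∫ u in s..t, mDensity D (γ u) * ‖deriv γ u‖) +
      (∫ u in t..1, mDensity D (γ u) * ‖deriv γ u‖) := by
    rw [intervalIntegral.integral_add_adjacent_intervals
      (m_integrable ho hD hb hK hin m0 ms) (m_integrable ho hD hb hK hin ms mt),
      intervalIntegral.integral_add_adjacent_intervals
      (m_integrable ho hD hb hK hin m0 mt) (m_integrable ho hD hb hK hin mt m1)]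
    rfl
  rw [← sub_le_iff_le_add]
  obtain ⟨σ0, hσ0, -⟩ := rect_sub hγ hs hst ht (mDensity D)
  refine le_csInf ⟨_, σ0, hσ0, rfl⟩ ?_
  rintro _ ⟨σ, hσ, rfl⟩
  obtain ⟨τ, hτ, eτ⟩ := mDist_trans ho hD hb hα hσ
  obtain ⟨ω, hω, eω⟩ := mDist_trans ho hD hb hτ hβ
  have := mDist_le ho hD hb hω
  linarith

/-! ### `m ≤ c j` implies uniform -/

lemma jDist_le_log {D : Set V} {x y : V} {m : ℝ} (hm : 0 < m) (hx : m ≤ bdist D x)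
    (hy : m ≤ bdist D y) : jDist D x y ≤ Real.log (1 + dist x y / m) := by
  rw [jDist_eq (hm.trans_le hx) (hm.trans_le hy)]
  have key : ∀ p, m ≤ p → Real.log (1 + dist x y / p) ≤ Real.log (1 + dist x y / m) := by
    intro p hp
    have h0 : 0 ≤ dist x y / p := div_nonneg dist_nonneg (hm.le.trans hp)
    have h1 : dist x y / p ≤ dist x y / m := div_le_div_of_nonneg_left dist_nonneg hm hp
    exact Real.log_le_log (by linarith) (by linarith)
  have := key _ hx
  have := key _ hy
  linarith

lemma uniform_segment {D : Set V} (ho : IsOpen D) (hD : D ≠ univ) {x y w : V} (hw : w ∈ D)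
    (hwx : dist x w ≤ dist x y) (hwy : dist y w ≤ dist x y)
    (hr : 2 * dist x y ≤ bdist D w) :
    ∃ γ : ℝ → V, IsRectPathIn D x y γ ∧
      (∀ t ∈ Set.Icc (0:ℝ) 1, min (subarcLength γ 0 t) (subarcLength γ t 1)
        ≤ ENNReal.ofReal (bdist D (γ t))) ∧
      subarcLength γ 0 1 ≤ ENNReal.ofReal (dist x y) := by
  have hpos := bdist_pos ho hD hw
  have hseg : segment ℝ x y ⊆ closedBall w (dist x y) :=
    (convex_closedBall w _).segment_subset hwx hwy
  have hlt : dist x y < bdist D w := by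
    have := dist_nonneg (x := x) (y := y)
    linarith
  have hsub : segment ℝ x y ⊆ D :=
    hseg.trans ((closedBall_subset_ball hlt).trans (ball_bdist_subset ho hD hw))
  have hlen : subarcLength (AffineMap.lineMap x y : ℝ → V) 0 1 ≤ ENNReal.ofReal (dist x y) := by
    have := variation_le_of_edist_le (γ := (AffineMap.lineMap x y : ℝ → V))
      (L := fun t => dist x y * t) zero_le_one
      (fun p _ q _ hpq => mul_le_mul_of_nonneg_left hpq dist_nonneg) (fun s _ t _ => by
        rw [edist_dist, edist_dist]
        apply ENNReal.ofReal_le_ofReal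
        rw [dist_lineMap_lineMap, Real.dist_eq (dist x y * s), ← mul_sub, abs_mul,
          abs_of_nonneg dist_nonneg, Real.dist_eq, mul_comm])
    unfold subarcLength
    simpa using this
  refine ⟨_, rect_segment hsub, fun t ht => ?_, hlen⟩
  refine (min_le_left _ _).trans ?_
  refine (eVariationOn.mono _ (Icc_subset_Icc_right ht.2)).trans (hlen.trans ?_)
  apply ENNReal.ofReal_le_ofReal
  have hmem : (AffineMap.lineMap x y : ℝ → V) t ∈ segment ℝ x y := by
    rw [segment_eq_image_lineMap]; exact ⟨t, ht, rfl⟩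
  have h1 := hseg hmem
  rw [mem_closedBall, dist_comm] at h1
  have h2 := bdist_le_add D w ((AffineMap.lineMap x y : ℝ → V) t)
  linarith

lemma backward_dir [Nontrivial V] {D : Set V} (ho : IsOpen D) (hD : D ≠ univ)
    (hb : Bornology.IsBounded D) (hcon : IsPreconnected D) {c : ℝ} (hc : 1 ≤ c)
    (hm : ∀ x ∈ D, ∀ y ∈ D, mDist D x y ≤ c * jDist D x y) : IsUniformDomain D := by
  set C := max 1 (max (goC c) (goQ c)) with hCdef
  have hC1 : 1 ≤ C := le_max_left _ _
  have hCC : goC c ≤ C := (le_max_left _ _).trans (le_max_right _ _)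
  have hCQ : goQ c ≤ C := (le_max_right _ _).trans (le_max_right _ _)
  refine ⟨C, hC1, fun x hx y hy => ?_⟩
  by_cases hcase : ∃ w ∈ D, dist x w ≤ dist x y ∧ dist y w ≤ dist x y ∧ 2 * dist x y ≤ bdist D w
  · obtain ⟨w, hw, h1, h2, h3⟩ := hcase
    obtain ⟨γ, hγ, g1, g2⟩ := uniform_segment ho hD hw h1 h2 h3
    refine ⟨γ, hγ, fun t ht => (g1 t ht).trans (ENNReal.ofReal_le_ofReal ?_),
      g2.trans (ENNReal.ofReal_le_ofReal ?_)⟩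
    · exact le_mul_of_one_le_left (bdist_pos ho hD (hγ.2.2.2 t ht)).le hC1
    · exact le_mul_of_one_le_left dist_nonneg hC1
  have hdx : bdist D x ≤ 2 * dist x y := by
    by_contra h
    exact hcase ⟨x, hx, by simp, by rw [dist_comm], (not_le.1 h).le⟩
  have hdy : bdist D y ≤ 2 * dist x y := by
    by_contra h
    exact hcase ⟨y, hy, le_rfl, by simp, (not_le.1 h).le⟩
  have hr : 0 < dist x y := by
    have := bdist_pos ho hD hx
    linarith
  obtain ⟨γ, hγ, hgeo⟩ := near_geodesic ho hD hb hcon hx hy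
  have hγ' := hγ
  obtain ⟨⟨K, hK⟩, h0, h1, hin⟩ := hγ'
  have m0 : (0:ℝ) ∈ Icc (0:ℝ) 1 := by simp
  have m1 : (1:ℝ) ∈ Icc (0:ℝ) 1 := by simp
  have mem : ∀ {s t u : ℝ}, 0 ≤ s → t ≤ 1 → u ∈ Icc s t → u ∈ Icc (0:ℝ) 1 :=
    fun h h' hu => ⟨h.trans hu.1, hu.2.trans h'⟩
  set L : ℝ → ℝ := fun t => ∫ u in (0:ℝ)..t, ‖deriv γ u‖ with hL
  set k : ℝ → ℝ := fun t => ∫ u in (0:ℝ)..t, mDensity D (γ u) * ‖deriv γ u‖ with hk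
  set d : ℝ → ℝ := fun t => bdist D (γ t) with hd
  have hpos : ∀ t ∈ Icc (0:ℝ) 1, 0 < d t := fun t ht => bdist_pos ho hD (hin t ht)
  have hdlip : LipschitzWith K d := by
    have := (bdist_lip D).comp hK
    rwa [one_mul] at this
  have hdc : ContinuousOn d (Icc 0 1) := hdlip.continuous.continuousOn
  have hLsub : ∀ s t, L t - L s = ∫ u in s..t, ‖deriv γ u‖ := fun s t =>
    intervalIntegral.integral_interval_sub_left (speed_integrable hK _ _) (speed_integrable hK _ _)
  have hksub : ∀ s t, s ∈ Icc (0:ℝ) 1 → t ∈ Icc (0:ℝ) 1 →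
      k t - k s = ∫ u in s..t, mDensity D (γ u) * ‖deriv γ u‖ := fun s t hs ht =>
    intervalIntegral.integral_interval_sub_left (m_integrable ho hD hb hK hin m0 ht)
      (m_integrable ho hD hb hK hin m0 hs)
  have hdist : ∀ s t, s ≤ t → dist (γ s) (γ t) ≤ L t - L s := fun s t hst => by
    rw [hLsub, dist_comm, dist_eq_norm]
    exact norm_sub_le_speed hK hst
  have hLm : Monotone L := fun s t hst => by
    have h1 := hdist s t hst
    have h2 := dist_nonneg (x := γ s) (y := γ t)
    linarith
  have hkm : MonotoneOn k (Icc 0 1) := fun s hs t ht hst => by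
    rw [← sub_nonneg, hksub s t hs ht]
    exact intervalIntegral.integral_nonneg hst fun u hu =>
      mul_nonneg (mDensity_nonneg ho hD hb (hin u (mem hs.1 ht.2 hu))) (norm_nonneg _)
  have main := go_full (c := c) (d := d) (L := L) (k := k) (Δ := fun s t => dist (γ s) (γ t))
    (r := dist x y) hc hdc hpos (hLm.monotoneOn _) hkm
    (by
      intro s t M hs hst ht hM
      have ms : s ∈ Icc (0:ℝ) 1 := ⟨hs, hst.trans ht⟩
      have mt : t ∈ Icc (0:ℝ) 1 := ⟨hs.trans hst, ht⟩
      rw [hLsub, hksub s t ms mt, ← intervalIntegral.integral_const_mul]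
      refine intervalIntegral.integral_mono_on hst (speed_integrable hK _ _)
        ((m_integrable ho hD hb hK hin ms mt).const_mul _) fun u hu => ?_
      have hu1 := mem hs ht hu
      have hp := hpos u hu1
      have i1 := inv_le_mDensity ho hD hb (hin u hu1)
      have i2 : 1 ≤ M * mDensity D (γ u) := by
        have j1 : d u * (d u)⁻¹ = 1 := mul_inv_cancel₀ hp.ne'
        have j2 : d u * (d u)⁻¹ ≤ M * mDensity D (γ u) :=
          mul_le_mul (hM u hu) i1 (inv_pos.2 hp).le (hp.le.trans (hM u hu))
        linarith
      rw [← mul_assoc]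
      exact le_mul_of_one_le_left (norm_nonneg _) i2)
    (by
      intro s t hs hst ht
      have ms : s ∈ Icc (0:ℝ) 1 := ⟨hs, hst.trans ht⟩
      have mt : t ∈ Icc (0:ℝ) 1 := ⟨hs.trans hst, ht⟩
      have hsub : Icc s t ⊆ Icc (0:ℝ) 1 := fun u hu => mem hs ht hu
      obtain ⟨p, hp, hpmin⟩ := isCompact_Icc.exists_isMinOn (nonempty_Icc.2 hst) (hdc.mono hsub)
      obtain ⟨K', hK'⟩ := log_lip (hpos p (hsub hp)) (hdlip.lipschitzOnWith (s := Icc s t))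
        (fun u hu => hpmin hu)
      have hder : ∀ᵐ u, u ∈ Ioo s t → DifferentiableAt ℝ d u ∧
          |deriv (fun u => Real.log (d u)) u| ≤ mDensity D (γ u) * ‖deriv γ u‖ := by
        filter_upwards [hdlip.ae_differentiableAt_real, hK.ae_differentiableAt_real] with u h1 h2 hu
        refine ⟨h1, ?_⟩
        have hu1 := hsub (Ioo_subset_Icc_self hu)
        have hp := hpos u hu1
        rw [(h1.hasDerivAt.log hp.ne').deriv, abs_div, abs_of_pos hp, div_eq_mul_inv, mul_comm]
        refine mul_le_mul (inv_le_mDensity ho hD hb (hin u hu1)) ?_ (abs_nonneg _)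
          (mDensity_nonneg ho hD hb (hin u hu1))
        have e1 := (hasDerivAt_iff_tendsto_slope.1 h1.hasDerivAt).norm
        have e2 := (hasDerivAt_iff_tendsto_slope.1 h2.hasDerivAt).norm
        refine le_of_tendsto_of_tendsto e1 e2 (Filter.Eventually.of_forall fun v => ?_)
        change ‖slope d u v‖ ≤ ‖slope γ u v‖
        rw [slope_def_module, slope_def_module, norm_smul, norm_smul]
        refine mul_le_mul_of_nonneg_left ?_ (norm_nonneg _)
        rw [← dist_eq_norm, ← dist_eq_norm]
        have := (bdist_lip D).dist_le_mul (γ v) (γ u)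
        rwa [NNReal.coe_one, one_mul] at this
      have hint := m_integrable ho hD hb hK hin ms mt
      rw [hksub s t ms mt, abs_le]
      constructor
      · have := ftc_le hst hK' hint (by
          filter_upwards [hder] with u hu hu'
          exact (le_abs_self _).trans (hu hu').2)
        linarith
      · have := ftc_ge hst hK' hint.neg (by
          filter_upwards [hder] with u hu hu'
          have := (abs_le.1 (hu hu').2).1
          exact this)
        simp only [Pi.neg_apply, intervalIntegral.integral_neg] at this
        linarith)
    (by
      intro s t m hs hst ht hm0 hms hmt
      have ms : s ∈ Icc (0:ℝ) 1 := ⟨hs, hst.trans ht⟩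
      have mt : t ∈ Icc (0:ℝ) 1 := ⟨hs.trans hst, ht⟩
      rw [hksub s t ms mt]
      have i1 := hgeo s t hs hst ht
      have i2 := hm _ (hin s ms) _ (hin t mt)
      have i3 := mul_le_mul_of_nonneg_left (jDist_le_log hm0 hms hmt) (by linarith : 0 ≤ c)
      linarith)
    (fun s t => dist_nonneg)
    (fun s t hs hst ht => hdist s t hst)
    (by
      intro s t hs hst ht
      have i1 := hdist 0 s hs
      have i2 := hdist t 1 ht
      rw [h0, dist_comm] at i1
      rw [h1, dist_comm] at i2
      have i3 := dist_triangle4 (γ s) x y (γ t)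
      linarith)
    hr (by rw [hd]; simp only; rw [h0]; exact hdx) (by rw [hd]; simp only; rw [h1]; exact hdy)
  obtain ⟨main1, main2⟩ := main
  have hvar : ∀ s t, s ≤ t → subarcLength γ s t ≤ ENNReal.ofReal (L t - L s) := by
    intro s t hst
    rw [hLsub]
    exact variation_le_speed hK hst
  refine ⟨γ, hγ, fun t ht => ?_, ?_⟩
  · have h2 : min (L t - L 0) (L 1 - L t) ≤ C * bdist D (γ t) :=
      (main1 t ht).trans (mul_le_mul_of_nonneg_right hCC (hpos t ht).le)
    rcases min_le_iff.1 h2 with h | h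
    · exact (min_le_left _ _).trans ((hvar 0 t ht.1).trans (ENNReal.ofReal_le_ofReal h))
    · exact (min_le_right _ _).trans ((hvar t 1 ht.2).trans (ENNReal.ofReal_le_ofReal h))
  · exact (hvar 0 1 zero_le_one).trans (ENNReal.ofReal_le_ofReal
      (main2.trans (mul_le_mul_of_nonneg_right hCQ hr.le)))

end Paths

/-- Proposition: characterization of uniform domains.
A bounded domain $D ⊂ ℝ^n$, $n ≥ 2$, is uniform iff there is $c_1 ≥ 1$ with
$m_D(x,y) ≤ c_1 j_D(x,y)$ for all $x, y ∈ D$. -/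
theorem isUniformDomain_iff_mDist_le_jDist {n : ℕ} (hn : 2 ≤ n)
    (D : Set (EuclideanSpace ℝ (Fin n)))
    (hDopen : IsOpen D) (hDconn : IsConnected D)
    (hDbdd : Bornology.IsBounded D) (hDproper : D ≠ Set.univ) :
    IsUniformDomain D ↔
      ∃ c₁ : ℝ, 1 ≤ c₁ ∧ ∀ x ∈ D, ∀ y ∈ D, mDist D x y ≤ c₁ * jDist D x y := by
  haveI : Nontrivial (EuclideanSpace ℝ (Fin n)) := by
    haveI : Nonempty (Fin n) := ⟨⟨0, by omega⟩⟩
    infer_instance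
  constructor
  · exact forward_dir hDopen hDproper hDbdd
  · rintro ⟨c, hc, h⟩
    exact backward_dir hDopen hDproper hDbdd hDconn.isPreconnected hc h
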